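/- arXiv:1505.07217 — 2 statements merged into one kernel-verified Lean document; each statement's English description precedes it below -/
import Mathlib

section
/- For every integer n ≥ 3, every real c > 0 and every x ≥ 0, one has γ(x) > x·γ'(x). -/
open Real Filter

noncomputable def alphaF (n : ℕ) (c : ℝ) (x : ℝ) : ℝ :=
  (n : ℝ) * c + ((n : ℝ) / (2 * ((n : ℝ) - 1))) * x
    - (((n : ℝ) - 2) / (2 * ((n : ℝ) - 1))) * Real.sqrt (x ^ 2 + 4 * ((n : ℝ) - 1) * c * x)

noncomputable def yn (n : ℕ) : ℝ :=
  4 * (1 - (n : ℝ)) + (2 * ((n : ℝ) ^ 2 - 4) / Real.sqrt (2 * (n : ℝ) - 5)) *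
    Real.cos ((1 / 3) * Real.arctan (((n : ℝ) ^ 2 - 4 * (n : ℝ) + 6) /
      (2 * ((n : ℝ) - 1) * Real.sqrt (2 * (n : ℝ) - 5))))

noncomputable def x0 (n : ℕ) (c : ℝ) : ℝ := yn n * c

noncomputable def betaF (n : ℕ) (c : ℝ) (x : ℝ) : ℝ :=
  alphaF n c (x0 n c) + deriv (alphaF n c) (x0 n c) * (x - x0 n c)
    + (1 / 2) * deriv (deriv (alphaF n c)) (x0 n c) * (x - x0 n c) ^ 2

noncomputable def gammaF (n : ℕ) (c : ℝ) (x : ℝ) : ℝ :=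
  if x0 n c ≤ x then alphaF n c x else betaF n c x

noncomputable def gammaF' (n : ℕ) (c : ℝ) (x : ℝ) : ℝ :=
  derivWithin (gammaF n c) (Set.Ici 0) x

noncomputable def gammaF'' (n : ℕ) (c : ℝ) (x : ℝ) : ℝ :=
  derivWithin (gammaF' n c) (Set.Ici 0) x

noncomputable def omegaF (n : ℕ) (c : ℝ) (x : ℝ) : ℝ :=
  (x ^ 2 / Real.sqrt (x ^ 2 + 4 * ((n : ℝ) - 1) * c * x)) *
    ((1 + (n : ℝ) ^ 2 * c / x) *
      (((n : ℝ) / ((n : ℝ) - 2) - (1 + 4 * ((n : ℝ) - 1) * c / x) ^ (-(1 / 2) : ℝ)) /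
       ((n : ℝ) / ((n : ℝ) - 2) + (1 + 4 * ((n : ℝ) - 1) * c / x) ^ (-(1 / 2) : ℝ)))) ^ 2

lemma radicand_pos {n : ℕ} (hn : 3 ≤ n) {c : ℝ} (hc : 0 < c) {x : ℝ} (hx : 0 < x) :
    0 < x ^ 2 + 4 * ((n : ℝ) - 1) * c * x := by
  have hn' : (3 : ℝ) ≤ n := by exact_mod_cast hn
  have : 0 < (n : ℝ) - 1 := by linarith
  positivity

lemma hasDerivAt_sqrt_radicand {n : ℕ} (hn : 3 ≤ n) {c : ℝ} (hc : 0 < c) {x : ℝ} (hx : 0 < x) :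
    HasDerivAt (fun y : ℝ => √(y ^ 2 + 4 * ((n : ℝ) - 1) * c * y))
      ((x + 2 * ((n : ℝ) - 1) * c) / √(x ^ 2 + 4 * ((n : ℝ) - 1) * c * x)) x := by
  have hq : HasDerivAt (fun y : ℝ => y ^ 2 + 4 * ((n : ℝ) - 1) * c * y)
      (2 * x + 4 * ((n : ℝ) - 1) * c) x := by
    simpa using (hasDerivAt_pow 2 x).fun_add ((hasDerivAt_id x).const_mul (4 * ((n : ℝ) - 1) * c))
  have hpos := radicand_pos hn hc hx
  convert hq.sqrt hpos.ne' using 1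
  have := (Real.sqrt_pos.2 hpos).ne'
  field_simp
  ring

lemma hasDerivAt_alphaF {n : ℕ} (hn : 3 ≤ n) {c : ℝ} (hc : 0 < c) {x : ℝ} (hx : 0 < x) :
    HasDerivAt (alphaF n c)
      ((n : ℝ) / (2 * ((n : ℝ) - 1)) - ((n : ℝ) - 2) / (2 * ((n : ℝ) - 1)) *
        ((x + 2 * ((n : ℝ) - 1) * c) / √(x ^ 2 + 4 * ((n : ℝ) - 1) * c * x))) x := by
  have h := (((hasDerivAt_id x).const_mul ((n : ℝ) / (2 * ((n : ℝ) - 1)))).const_add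
    ((n : ℝ) * c)).sub ((hasDerivAt_sqrt_radicand hn hc hx).const_mul
      (((n : ℝ) - 2) / (2 * ((n : ℝ) - 1))))
  rw [mul_one] at h
  exact h

lemma deriv_deriv_alphaF_nonneg {n : ℕ} (hn : 3 ≤ n) {c : ℝ} (hc : 0 < c) {x : ℝ} (hx : 0 < x) :
    0 ≤ deriv (deriv (alphaF n c)) x := by
  have hn' : (3 : ℝ) ≤ n := by exact_mod_cast hn
  have hpos := radicand_pos hn hc hx
  have hS := Real.sqrt_pos.2 hpos
  have hev : deriv (alphaF n c) =ᶠ[nhds x] fun y => (n : ℝ) / (2 * ((n : ℝ) - 1)) -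
      ((n : ℝ) - 2) / (2 * ((n : ℝ) - 1)) *
        ((y + 2 * ((n : ℝ) - 1) * c) / √(y ^ 2 + 4 * ((n : ℝ) - 1) * c * y)) := by
    filter_upwards [lt_mem_nhds hx] with y hy using (hasDerivAt_alphaF hn hc hy).deriv
  have hd := ((((hasDerivAt_id x).add_const (2 * ((n : ℝ) - 1) * c)).div
    (hasDerivAt_sqrt_radicand hn hc hx) hS.ne').const_mul
      (((n : ℝ) - 2) / (2 * ((n : ℝ) - 1)))).const_sub ((n : ℝ) / (2 * ((n : ℝ) - 1)))
  rw [hev.deriv_eq]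
  refine le_of_le_of_eq ?_ hd.deriv.symm
  rw [← mul_neg]
  refine mul_nonneg (div_nonneg (by linarith) (by linarith)) ?_
  rw [← neg_div]
  refine div_nonneg ?_ (sq_nonneg _)
  simp only [id, one_mul, neg_sub, sub_nonneg]
  rw [mul_div_assoc', le_div_iff₀ hS, Real.mul_self_sqrt hpos.le]
  nlinarith [sq_nonneg (2 * ((n : ℝ) - 1) * c)]

lemma mul_deriv_alphaF_lt {n : ℕ} (hn : 3 ≤ n) {c : ℝ} (hc : 0 < c) {x : ℝ} (hx : 0 < x) :
    x * deriv (alphaF n c) x < alphaF n c x := by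
  have hn' : (3 : ℝ) ≤ n := by exact_mod_cast hn
  have hn1 : (n : ℝ) - 1 ≠ 0 := by linarith
  have hpos := radicand_pos hn hc hx
  have hS := Real.sqrt_pos.2 hpos
  have hxS : x ≤ √(x ^ 2 + 4 * ((n : ℝ) - 1) * c * x) := by
    refine Real.le_sqrt_of_sq_le ?_
    have : 0 < 4 * ((n : ℝ) - 1) * c * x := by
      have : 0 < (n : ℝ) - 1 := by linarith
      positivity
    linarith
  have hsq := Real.sq_sqrt hpos.le
  have key : alphaF n c x - x * deriv (alphaF n c) x =
      n * c - (n - 2) * c * (x / √(x ^ 2 + 4 * ((n : ℝ) - 1) * c * x)) := by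
    rw [(hasDerivAt_alphaF hn hc hx).deriv, alphaF]
    generalize √(x ^ 2 + 4 * ((n : ℝ) - 1) * c * x) = S at *
    field_simp
    linear_combination (-((n : ℝ) - 2)) * hsq
  have h1 : x / √(x ^ 2 + 4 * ((n : ℝ) - 1) * c * x) ≤ 1 := (div_le_one hS).2 hxS
  have h2 : 0 ≤ ((n : ℝ) - 2) * c := mul_nonneg (by linarith) hc.le
  nlinarith [mul_le_mul_of_nonneg_left h1 h2]

lemma hasDerivAt_betaF (n : ℕ) (c x : ℝ) :
    HasDerivAt (betaF n c) (deriv (alphaF n c) (x0 n c) +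
      deriv (deriv (alphaF n c)) (x0 n c) * (x - x0 n c)) x := by
  have h := (hasDerivAt_id x).sub_const (x0 n c)
  have hβ := ((h.const_mul (deriv (alphaF n c) (x0 n c))).const_add
    (alphaF n c (x0 n c))).fun_add
      ((h.fun_pow 2).const_mul ((1 / 2) * deriv (deriv (alphaF n c)) (x0 n c)))
  refine HasDerivAt.congr_deriv hβ ?_
  simp only [id, Nat.cast_ofNat, Nat.add_one_sub_one, pow_one]
  ring

lemma mul_deriv_betaF_lt {n : ℕ} (hn : 3 ≤ n) {c : ℝ} (hc : 0 < c) {x : ℝ} (hx : 0 ≤ x)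
    (hx' : x < x0 n c) : x * deriv (betaF n c) x < betaF n c x := by
  have h0 : 0 < x0 n c := hx.trans_lt hx'
  have h1 := mul_deriv_alphaF_lt hn hc h0
  have h2 := mul_nonneg (deriv_deriv_alphaF_nonneg hn hc h0)
    (mul_nonneg (sub_nonneg.2 hx'.le) (add_nonneg h0.le hx))
  rw [(hasDerivAt_betaF n c x).deriv, betaF]
  linarith

lemma gammaF'_eq_of_hasDerivAt {n : ℕ} {c x d : ℝ} (hx : 0 ≤ x)
    (h : HasDerivAt (gammaF n c) d x) : gammaF' n c x = d :=
  h.hasDerivWithinAt.derivWithin (uniqueDiffOn_Ici 0 x hx)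

lemma hasDerivAt_gammaF_of_lt {n : ℕ} {c x : ℝ} (h : x < x0 n c) :
    HasDerivAt (gammaF n c) (deriv (betaF n c) x) x := by
  refine (hasDerivAt_betaF n c x).differentiableAt.hasDerivAt.congr_of_eventuallyEq ?_
  filter_upwards [gt_mem_nhds h] with y hy using if_neg (not_le.2 hy)

lemma hasDerivAt_gammaF_of_le {n : ℕ} (hn : 3 ≤ n) {c : ℝ} (hc : 0 < c) {x : ℝ} (hx : 0 < x)
    (h : x0 n c ≤ x) : HasDerivAt (gammaF n c) (deriv (alphaF n c) x) x := by
  have hα := (hasDerivAt_alphaF hn hc hx).differentiableAt.hasDerivAt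
  rcases h.lt_or_eq with h | rfl
  · refine hα.congr_of_eventuallyEq ?_
    filter_upwards [lt_mem_nhds h] with y hy using if_pos hy.le
  · have hβ := hasDerivAt_betaF n c (x0 n c)
    rw [sub_self, mul_zero, add_zero] at hβ
    have hβα : betaF n c (x0 n c) = alphaF n c (x0 n c) := by simp [betaF]
    have hr : HasDerivWithinAt (gammaF n c) (deriv (alphaF n c) (x0 n c))
        (Set.Ici (x0 n c)) (x0 n c) :=
      hα.hasDerivWithinAt.congr (fun y hy => if_pos hy) (if_pos le_rfl)
    have hl : HasDerivWithinAt (gammaF n c) (deriv (alphaF n c) (x0 n c))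
        (Set.Iio (x0 n c)) (x0 n c) :=
      hβ.hasDerivWithinAt.congr (fun y hy => if_neg (not_le.2 hy))
        ((if_pos le_rfl).trans hβα.symm)
    have hu := hl.union hr
    rwa [Set.Iio_union_Ici, hasDerivWithinAt_univ] at hu

theorem stmt_5 (n : ℕ) (hn : 3 ≤ n) (c : ℝ) (hc : 0 < c) (x : ℝ) (hx : 0 ≤ x) :
    gammaF n c x > x * gammaF' n c x := by
  rcases lt_or_ge x (x0 n c) with h | h
  · rw [gammaF'_eq_of_hasDerivAt hx (hasDerivAt_gammaF_of_lt h), gammaF, if_neg (not_le.2 h)]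
    exact mul_deriv_betaF_lt hn hc hx h
  · rw [gammaF, if_pos h]
    rcases hx.eq_or_lt with rfl | hx
    · have : 0 < (n : ℝ) := by positivity
      simp only [alphaF]
      simpa using mul_pos this hc
    · rw [gammaF'_eq_of_hasDerivAt hx.le (hasDerivAt_gammaF_of_le hn hc hx h)]
      exact mul_deriv_alphaF_lt hn hc hx
end

section
/- For every integer n ≥ 3, every real c > 0 and every x ≥ 0, one has x/(n−1) + 2c < γ(x) < x/(n−1) + n·c. -/
open Real Filter

theorem yn_pos {n : ℕ} (hn : 3 ≤ n) : 0 < yn n := by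
  have hn' : (3 : ℝ) ≤ n := by exact_mod_cast hn
  unfold yn
  generalize (n : ℝ) = v at hn'
  set θ := arctan ((v ^ 2 - 4 * v + 6) / (2 * (v - 1) * √(2 * v - 5)))
  have hθ : θ < π / 2 := arctan_lt_pi_div_two _
  have hθ' : 0 ≤ θ := by
    refine arctan_nonneg.2 (div_nonneg (by nlinarith [sq_nonneg (v - 2)]) ?_)
    exact mul_nonneg (by linarith) (sqrt_nonneg _)
  have hcos : √3 / 2 < cos (1 / 3 * θ) := by
    rw [← cos_pi_div_six]
    exact cos_lt_cos_of_nonneg_of_le_pi (by linarith) (by linarith [pi_pos]) (by linarith)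
  have hr : 0 < √(2 * v - 5) := sqrt_pos.2 (by linarith)
  have hr2 : √(2 * v - 5) ^ 2 = 2 * v - 5 := sq_sqrt (by linarith)
  have h3 : √(3 : ℝ) ^ 2 = 3 := sq_sqrt (by norm_num)
  generalize √(2 * v - 5) = r at hr hr2
  have hv : 0 < v ^ 2 - 4 := by nlinarith
  have key : 4 * (v - 1) * r ≤ (v ^ 2 - 4) * √3 := by
    refine le_of_sq_le_sq ?_ (mul_nonneg hv.le (sqrt_nonneg _))
    rw [mul_pow, mul_pow, mul_pow, hr2, h3]
    nlinarith [mul_nonneg (sq_nonneg (v - 4)) (by nlinarith : 0 ≤ 3 * v ^ 2 - 8 * v + 8)]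
  have hlt : 4 * (v - 1) < 2 * (v ^ 2 - 4) / r * cos (1 / 3 * θ) := by
    rw [div_mul_eq_mul_div, lt_div_iff₀ hr]
    nlinarith [mul_lt_mul_of_pos_left hcos hv]
  linarith

theorem hasDerivAt_sqrt_sq_add_mul {b x : ℝ} (hb : 0 ≤ b) (hx : 0 < x) :
    HasDerivAt (fun y => √(y ^ 2 + b * y)) ((2 * x + b) / (2 * √(x ^ 2 + b * x))) x := by
  have h : HasDerivAt (fun y => y ^ 2 + b * y) (2 * x + b) x := by
    simpa using (hasDerivAt_pow 2 x).fun_add ((hasDerivAt_id x).const_mul b)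
  exact h.sqrt (by positivity)

theorem deriv_alphaF {n : ℕ} (hn : 1 ≤ n) {c x : ℝ} (hc : 0 ≤ c) (hx : 0 < x) :
    deriv (alphaF n c) x = (n : ℝ) / (2 * (n - 1)) - ((n : ℝ) - 2) / (2 * (n - 1)) *
      ((2 * x + 4 * (n - 1) * c) / (2 * √(x ^ 2 + 4 * (n - 1) * c * x))) := by
  have hn' : (1 : ℝ) ≤ n := by exact_mod_cast hn
  have hb : 0 ≤ 4 * ((n : ℝ) - 1) * c := mul_nonneg (by linarith) hc
  have h := ((((hasDerivAt_id x).const_mul ((n : ℝ) / (2 * (n - 1)))).const_add (n * c)).sub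
    ((hasDerivAt_sqrt_sq_add_mul hb hx).const_mul (((n : ℝ) - 2) / (2 * (n - 1))))).deriv
  rw [mul_one] at h
  exact h

theorem deriv_deriv_alphaF {n : ℕ} (hn : 1 < n) {c x : ℝ} (hc : 0 ≤ c) (hx : 0 < x) :
    deriv (deriv (alphaF n c)) x =
      2 * ((n : ℝ) - 1) * (n - 2) * c ^ 2 / √(x ^ 2 + 4 * (n - 1) * c * x) ^ 3 := by
  have hn' : (1 : ℝ) < n := by exact_mod_cast hn
  have hb : 0 ≤ 4 * ((n : ℝ) - 1) * c := mul_nonneg (by linarith) hc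
  have hpos : 0 < x ^ 2 + 4 * ((n : ℝ) - 1) * c * x := by positivity
  have hs : 0 < √(x ^ 2 + 4 * ((n : ℝ) - 1) * c * x) := sqrt_pos.2 hpos
  have hs2 := sq_sqrt hpos.le
  have heq : deriv (alphaF n c) =ᶠ[nhds x] fun x => (n : ℝ) / (2 * (n - 1)) -
      ((n : ℝ) - 2) / (2 * (n - 1)) *
      ((2 * x + 4 * (n - 1) * c) / (2 * √(x ^ 2 + 4 * (n - 1) * c * x))) := by
    filter_upwards [lt_mem_nhds hx] with y hy using deriv_alphaF hn.le hc hy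
  rw [heq.deriv_eq]
  have h1 : HasDerivAt (fun y : ℝ => 2 * y + 4 * ((n : ℝ) - 1) * c) 2 x := by
    simpa using ((hasDerivAt_id x).const_mul 2).add_const (4 * ((n : ℝ) - 1) * c)
  have h := (((h1.div ((hasDerivAt_sqrt_sq_add_mul hb hx).const_mul 2)
    (by positivity)).const_mul (((n : ℝ) - 2) / (2 * (n - 1)))).const_sub
    ((n : ℝ) / (2 * (n - 1)))).deriv
  refine h.trans ?_
  generalize √(x ^ 2 + 4 * ((n : ℝ) - 1) * c * x) = s at hs hs2 ⊢
  have hm : (n : ℝ) - 1 ≠ 0 := by linarith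
  field_simp
  rw [hs2]
  ring

theorem stmt_7 (n : ℕ) (hn : 3 ≤ n) (c : ℝ) (hc : 0 < c) (x : ℝ) (hx : 0 ≤ x) :
    x / ((n : ℝ) - 1) + 2 * c < gammaF n c x ∧ gammaF n c x < x / ((n : ℝ) - 1) + (n : ℝ) * c := by
  have hn' : (3 : ℝ) ≤ n := by exact_mod_cast hn
  have hx0 : 0 < x0 n c := mul_pos (yn_pos hn) hc
  unfold gammaF betaF
  generalize x0 n c = a at hx0
  have hm : 0 < (n : ℝ) - 1 := by linarith
  have hmc : 0 < ((n : ℝ) - 1) * c := mul_pos hm hc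
  have hk : 0 < ((n : ℝ) - 2) / (2 * (n - 1)) := div_pos (by linarith) (by linarith)
  have sqrt_bounds : ∀ y : ℝ, 0 < y → y < √(y ^ 2 + 4 * (n - 1) * c * y) ∧
      √(y ^ 2 + 4 * (n - 1) * c * y) < y + 2 * (n - 1) * c := fun y hy =>
    ⟨lt_sqrt_of_sq_lt (by nlinarith [mul_pos hmc hy]),
      (sqrt_lt' (by nlinarith)).2 (by nlinarith [mul_pos hmc hmc])⟩
  have alphaF_eq : ∀ y, alphaF n c y = y / ((n : ℝ) - 1) + n * c -
      ((n : ℝ) - 2) / (2 * (n - 1)) * (√(y ^ 2 + 4 * (n - 1) * c * y) - y) := fun y => by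
    unfold alphaF
    field_simp
    ring
  have alphaF_eq' : ∀ y, alphaF n c y = y / ((n : ℝ) - 1) + 2 * c +
      ((n : ℝ) - 2) / (2 * (n - 1)) *
        (y + 2 * (n - 1) * c - √(y ^ 2 + 4 * (n - 1) * c * y)) := fun y => by
    unfold alphaF
    field_simp
    ring
  split_ifs with hax
  · obtain ⟨h1, h2⟩ := sqrt_bounds x (by linarith)
    constructor
    · rw [alphaF_eq']
      linarith [mul_pos hk (sub_pos.2 h2)]
    · rw [alphaF_eq]
      linarith [mul_pos hk (sub_pos.2 h1)]
  · push Not at hax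
    obtain ⟨h1, h2⟩ := sqrt_bounds a hx0
    have hs2 : √(a ^ 2 + 4 * (n - 1) * c * a) ^ 2 = a ^ 2 + 4 * (n - 1) * c * a :=
      sq_sqrt (by nlinarith [mul_pos hmc hx0])
    rw [deriv_alphaF (by lia) hc.le hx0, deriv_deriv_alphaF (by lia) hc.le hx0]
    constructor
    · rw [alphaF_eq']
      generalize √(a ^ 2 + 4 * (n - 1) * c * a) = s at h1 h2 hs2 ⊢
      have hs : 0 < s := hx0.trans h1
      have e : a / ((n : ℝ) - 1) + 2 * c + ((n : ℝ) - 2) / (2 * (n - 1)) *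
          (a + 2 * (n - 1) * c - s) + ((n : ℝ) / (2 * (n - 1)) - ((n : ℝ) - 2) / (2 * (n - 1)) *
          ((2 * a + 4 * (n - 1) * c) / (2 * s))) * (x - a) +
          1 / 2 * (2 * ((n : ℝ) - 1) * (n - 2) * c ^ 2 / s ^ 3) * (x - a) ^ 2 =
          x / ((n : ℝ) - 1) + 2 * c + ((n : ℝ) - 2) / (2 * (n - 1)) *
          ((a + 2 * (n - 1) * c - s) + (a + 2 * (n - 1) * c - s) * (a - x) / s +
            2 * ((n - 1) * c) ^ 2 / s ^ 3 * (a - x) ^ 2) := by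
        field_simp
        ring
      rw [e, lt_add_iff_pos_right]
      have := sub_pos.2 h2
      have := sub_pos.2 hax
      positivity
    · rw [alphaF_eq]
      generalize √(a ^ 2 + 4 * (n - 1) * c * a) = s at h1 h2 hs2 ⊢
      have hs : 0 < s := hx0.trans h1
      have e : a / ((n : ℝ) - 1) + n * c - ((n : ℝ) - 2) / (2 * (n - 1)) *
          (s - a) + ((n : ℝ) / (2 * (n - 1)) - ((n : ℝ) - 2) / (2 * (n - 1)) *
          ((2 * a + 4 * (n - 1) * c) / (2 * s))) * (x - a) +
          1 / 2 * (2 * ((n : ℝ) - 1) * (n - 2) * c ^ 2 / s ^ 3) * (x - a) ^ 2 =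
          x / ((n : ℝ) - 1) + n * c - ((n : ℝ) - 2) / (2 * (n - 1)) *
          ((s ^ 2 * (s ^ 2 - s * x - (a + 2 * (n - 1) * c) * (a - x)) -
            2 * ((n - 1) * c) ^ 2 * (a - x) ^ 2) / s ^ 3) := by
        field_simp
        ring
      rw [e, sub_lt_self_iff]
      refine mul_pos hk (div_pos ?_ (by positivity))
      have hs2' : s ^ 2 = a ^ 2 + 4 * ((n - 1) * c) * a := by linarith
      rw [mul_assoc 2 ((n : ℝ) - 1) c]
      generalize ((n : ℝ) - 1) * c = p at hmc hs2' ⊢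
      have hsa : 0 < s - a := sub_pos.2 h1
      have hxa : 0 < a - x := sub_pos.2 hax
      refine (mul_pos_iff_of_pos_left hx0).1 ?_
      -- concavity in `x`: compare with the chord between `0` and `a`
      have chord : a * (s ^ 2 * (s ^ 2 - s * x - (a + 2 * p) * (a - x)) - 2 * p ^ 2 * (a - x) ^ 2) =
          x * (s ^ 3 * (s - a)) + (a - x) * (2 * p * a * (a ^ 2 + 3 * p * a)) +
            2 * p ^ 2 * a * ((a - x) * x) := by
        linear_combination (a - x) * (s ^ 2 + 2 * p * a) * hs2'
      rw [chord]
      positivity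
end
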